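/- Let J be a reduced Albert algebra over a field F of characteristic not 2 or 3 and let Δ be a quadratic étale F-algebra. Then B(J,Δ) is similar to B(J,F×F): for some (equivalently, any) choices of nonzero skew-symmetric elements in the two algebras, there exist a bijective F-linear map f: B(J,Δ) → B(J,F×F) and λ ∈ F^× which form a similarity between the associated triple systems. -/

import Mathlib

set_option synthInstance.maxHeartbeats 1000000
set_option maxHeartbeats 1000000

noncomputable section

open scoped TensorProduct

universe u v

structure OctonionAlgebra (F : Type u) [Field F] : Type (max u (v + 1)) where
  C : Type v
  [ringC : NonAssocRing C]
  [modC : Module F C]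
  [sccC : SMulCommClass F C C]
  [istC : IsScalarTower F C C]
  n : QuadraticForm F C
  finrank_eq : Module.finrank F C = 8
  nondeg : ∀ x : C, (∀ y : C, QuadraticMap.polar (⇑n) x y = 0) → x = 0
  n_one : n 1 = 1
  n_mul : ∀ x y : C, n (x * y) = n x * n y

attribute [instance] OctonionAlgebra.ringC OctonionAlgebra.modC OctonionAlgebra.sccC
  OctonionAlgebra.istC

namespace OctonionAlgebra

variable {F : Type u} [Field F] (O : OctonionAlgebra.{u, v} F)

/-- Conjugation `x̄ := n(x,1)•1 - x` (bundled as a linear map; `polarBilin n x 1 = n(x,1)`). -/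
def conj : O.C →ₗ[F] O.C :=
  (LinearMap.toSpanSingleton F O.C (1 : O.C)).comp ((QuadraticMap.polarBilin O.n).flip 1)
    - LinearMap.id

lemma conj_apply (x : O.C) :
    O.conj x = QuadraticMap.polar (⇑O.n) x 1 • (1 : O.C) - x := rfl

/-- A split octonion algebra: the norm form is isotropic. -/
def IsSplit : Prop := ∃ x : O.C, x ≠ 0 ∧ O.n x = 0

end OctonionAlgebra

/-- A reduced Albert algebra `H₃(C,γ)`. -/
structure ReducedAlbert (F : Type u) [Field F] : Type (max u (v + 1)) where
  O : OctonionAlgebra.{u, v} F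
  γ : Fin 3 → Fˣ

namespace ReducedAlbert

variable {F : Type u} [Field F] (A : ReducedAlbert.{u, v} F)

/-- The ambient space of 3×3 matrices over the octonion algebra. -/
abbrev M : Type v := Matrix (Fin 3) (Fin 3) A.O.C

/-- The 27-dimensional space `H₃(C,γ)` of `γ`-hermitian matrices:
`x = γ⁻¹ ⬝ (x̄)ᵀ ⬝ γ`, i.e. entrywise `x i j = γᵢ⁻¹ γⱼ • conj (x j i)`. -/
def J : Submodule F A.M where
  carrier := {x | ∀ i j, x i j = ((A.γ i : F)⁻¹ * (A.γ j : F)) • A.O.conj (x j i)}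
  add_mem' := by
    intro a b ha hb i j
    show a i j + b i j = ((A.γ i : F)⁻¹ * (A.γ j : F)) • A.O.conj (a j i + b j i)
    rw [map_add, smul_add, ← ha i j, ← hb i j]
  zero_mem' := by
    intro i j
    show (0 : A.O.C) = ((A.γ i : F)⁻¹ * (A.γ j : F)) • A.O.conj (0 : A.O.C)
    rw [map_zero, smul_zero]
  smul_mem' := by
    intro c a ha i j
    show c • a i j = ((A.γ i : F)⁻¹ * (A.γ j : F)) • A.O.conj (c • a j i)
    rw [map_smul, smul_comm, ← ha i j]

/-- The Jordan product `x·y := (xy + yx)/2`. -/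
def jmul (x y : A.M) : A.M := (2 : F)⁻¹ • (x * y + y * x)

/-- The trace `T(x)`: the sum of the diagonal entries, which for hermitian matrices are
scalars `ε•1`; the scalar `ε` is recovered as `n(ε•1, 1)/2`. -/
def trace (x : A.M) : F := (2 : F)⁻¹ * ∑ i, QuadraticMap.polar (⇑A.O.n) (x i i) 1

/-- The trace bilinear form `T(x,y) := T(x·y)`. -/
def tb (x y : A.M) : F := A.trace (A.jmul x y)

/-- The adjoint `x ^ # = x·x − T(x)·x + ½(T(x)² − T(x,x))·1`, the unique quadratic map such
that `T(x^#, y)` is the coefficient of `s` in `N(x + s y)`. -/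
def sharp (x : A.M) : A.M :=
  A.jmul x x - A.trace x • x + ((2 : F)⁻¹ * (A.trace x ^ 2 - A.tb x x)) • (1 : A.M)

/-- The Freudenthal cross product `x × y := (x+y)^# − x^# − y^#`. -/
def cross (x y : A.M) : A.M := A.sharp (x + y) - A.sharp x - A.sharp y

/-- The cubic norm `N`, defined pointwise on `J` by
`N(x)·1 = x·(x·x) − T(x)·(x·x) + ½(T(x)² − T(x,x))·x`; the scalar is recovered by
applying the trace (which takes value `3` on `1`). -/
def norm (x : A.M) : F :=
  (3 : F)⁻¹ * A.trace (A.jmul x (A.jmul x x) - A.trace x • A.jmul x x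
    + ((2 : F)⁻¹ * (A.trace x ^ 2 - A.tb x x)) • x)

/-- The operator `⟨x,y⟩(j) := ½ (y × (x × j) − T(j,y)·x − ⅓·T(x,y)·j)`. -/
def brok (x y j : A.M) : A.M :=
  (2 : F)⁻¹ • (A.cross y (A.cross x j) - A.tb j y • x - ((3 : F)⁻¹ * A.tb x y) • j)

/-- `A` is the split Albert algebra `H₃(Cᵈ, 1)`. -/
def IsSplitAlbert : Prop := A.O.IsSplit ∧ ∀ i, A.γ i = 1

/-- A point of `H₃(C,γ)` with coordinates `(ε₀,ε₁,ε₂; a,b,c)`. -/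
def elt (ε : Fin 3 → F) (a b c : A.O.C) : A.M :=
  Matrix.of
    ![![ε 0 • (1 : A.O.C), c, ((A.γ 0 : F)⁻¹ * (A.γ 2 : F)) • A.O.conj b],
      ![((A.γ 1 : F)⁻¹ * (A.γ 0 : F)) • A.O.conj c, ε 1 • (1 : A.O.C), a],
      ![b, ((A.γ 2 : F)⁻¹ * (A.γ 1 : F)) • A.O.conj a, ε 2 • (1 : A.O.C)]]

/-! ### The Brown algebra `B(J, F×F, ζ)` -/

/-- Ambient space of the Brown algebra `B(J, F×F, ζ)`: elements `(α, j; j', β)`. -/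
abbrev Bam : Type (max u v) := F × A.M × A.M × F

/-- The underlying 56-dimensional space of `B(J, F×F, ζ)`: both middle components lie in `J`. -/
def Bsub : Submodule F A.Bam where
  carrier := {p | p.2.1 ∈ A.J ∧ p.2.2.1 ∈ A.J}
  add_mem' := fun ha hb => ⟨A.J.add_mem ha.1 hb.1, A.J.add_mem ha.2 hb.2⟩
  zero_mem' := ⟨A.J.zero_mem, A.J.zero_mem⟩
  smul_mem' := fun c _ h => ⟨A.J.smul_mem c h.1, A.J.smul_mem c h.2⟩

/-- The product of `B(J, F×F, ζ)`. -/
def bmul (ζ : F) (x y : A.Bam) : A.Bam :=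
  (x.1 * y.1 + ζ * A.tb x.2.1 y.2.2.1,
   x.1 • y.2.1 + y.2.2.2 • x.2.1 + ζ • A.cross x.2.2.1 y.2.2.1,
   y.1 • x.2.2.1 + x.2.2.2 • y.2.2.1 + A.cross x.2.1 y.2.1,
   x.2.2.2 * y.2.2.2 + ζ * A.tb y.2.1 x.2.2.1)

/-- The involution `(α,j;j',β)‾ = (β,j;j',α)` of `B(J, F×F, ζ)`. -/
def binv (x : A.Bam) : A.Bam := (x.2.2.2, x.2.1, x.2.2.1, x.1)

/-- The skew-symmetric element `s₀ = (1,0;0,−1)`. -/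
def s0 : A.Bam := (1, 0, 0, -1)

/-- The triple product `{x,y,z} := (x·ȳ)·z + (z·ȳ)·x − (z·x̄)·y` in `B(J, F×F, ζ)`. -/
def brace (ζ : F) (x y z : A.Bam) : A.Bam :=
  A.bmul ζ (A.bmul ζ x (A.binv y)) z + A.bmul ζ (A.bmul ζ z (A.binv y)) x
    - A.bmul ζ (A.bmul ζ z (A.binv x)) y

/-- The bilinear form of the triple system associated to `B(J, F×F, ζ)` and a skew element
`s`: `b(x,y)` is the unique scalar with `b(x,y)•1 = (x·ȳ − y·x̄)·s`; since the unit of the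
algebra is `(1,0;0,1)`, it is the first component of the right-hand side. -/
def bformS (ζ : F) (s x y : A.Bam) : F :=
  (A.bmul ζ (A.bmul ζ x (A.binv y) - A.bmul ζ y (A.binv x)) s).1

/-- The trilinear product of the triple system associated to `B(J, F×F, ζ)` and `s`:
`t(y,z,w) := 2{y, s·z, w} − b(z,w)·y − b(z,y)·w − b(y,w)·z`. -/
def tformS (ζ : F) (s y z w : A.Bam) : A.Bam :=
  (2 : F) • A.brace ζ y (A.bmul ζ s z) w - A.bformS ζ s z w • y - A.bformS ζ s z y • w
    - A.bformS ζ s y w • z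

/-- The bilinear form of the triple system associated to `B(J, F×F, ζ)` and `s₀`. -/
def bform (ζ : F) (x y : A.Bam) : F := A.bformS ζ A.s0 x y

/-- The trilinear product of the triple system associated to `B(J, F×F, ζ)` and `s₀`. -/
def tform (ζ : F) (y z w : A.Bam) : A.Bam := A.tformS ζ A.s0 y z w

/-- `e` is a singular element of `B(J, F×F, ζ)`: `e ≠ 0` and `U_e(B) ⊆ F·e`
where `U_e(x) := {e,x,e}`. -/
def IsSingular (ζ : F) (e : A.Bam) : Prop :=
  e ≠ 0 ∧ ∀ x ∈ A.Bsub, ∃ c : F, A.brace ζ e x e = c • e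

/-- `I` is an inner ideal of `B(J, F×F, ζ)`: a subspace of `B` with `U_e(B) ⊆ I`
for all `e ∈ I`. -/
def IsInnerIdeal (ζ : F) (I : Submodule F A.Bam) : Prop :=
  I ≤ A.Bsub ∧ ∀ e ∈ I, ∀ x ∈ A.Bsub, A.brace ζ e x e ∈ I

end ReducedAlbert


namespace ReducedAlbert

variable {F : Type u} [Field F] (A : ReducedAlbert.{u, v} F)

/-! In characteristic `≠ 2` a quadratic étale `F`-algebra is `Δ = F(√d) = F ⊕ F·δ` with
`δ² = d ∈ F^×` (the case of a square `d` giving `Δ ≅ F × F`), and `ι(δ) = -δ`.  We model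
`B(J,F×F) ⊗_F Δ` by pairs `x + y·δ ↝ (x,y)` of elements of the ambient space of `B(J,F×F)`. -/

/-- The multiplication of `B(J,F×F) ⊗_F Δ` in the pair model: `δ² = d`. -/
def dmul (d : F) (x y : A.Bam × A.Bam) : A.Bam × A.Bam :=
  (A.bmul 1 x.1 y.1 + d • A.bmul 1 x.2 y.2, A.bmul 1 x.1 y.2 + A.bmul 1 x.2 y.1)

/-- The involution of `B(J,F×F) ⊗_F Δ` (acting trivially on `Δ`). -/
def dinv (x : A.Bam × A.Bam) : A.Bam × A.Bam := (A.binv x.1, A.binv x.2)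

/-- The outer automorphism `ϖ(α,j;j',β) = (β,j';j,α)` of `B(J,F×F)`. -/
def varpi (x : A.Bam) : A.Bam := (x.2.2.2, x.2.2.1, x.2.1, x.1)

/-- `B(J,Δ)`: the elements of `B(J,F×F) ⊗_F Δ` fixed by `ϖ ⊗ ι` (where `ι(δ) = -δ`), with
components in the 56-dimensional subspace. -/
def Dsub (A : ReducedAlbert.{u, v} F) : Set (A.Bam × A.Bam) :=
  {p | p.1 ∈ A.Bsub ∧ p.2 ∈ A.Bsub ∧ A.varpi p.1 = p.1 ∧ A.varpi p.2 = -p.2}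

/-- The element `δ·(1,0;0,−1)` spanning the skew-symmetric elements of `B(J,Δ)`. -/
def ds0 : A.Bam × A.Bam := (0, A.s0)

/-- The triple product `{x,y,z}` in `B(J,Δ) ⊗ Δ`-model. -/
def dbrace (d : F) (x y z : A.Bam × A.Bam) : A.Bam × A.Bam :=
  A.dmul d (A.dmul d x (A.dinv y)) z + A.dmul d (A.dmul d z (A.dinv y)) x
    - A.dmul d (A.dmul d z (A.dinv x)) y

/-- The bilinear form of the triple system associated to `B(J,Δ)` and a skew element `s`:
`b(x,y)•1 = (x·ȳ − y·x̄)·s`, the scalar being read off against the unit `((1,0,0,1),0)`. -/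
def dbform (d : F) (s x y : A.Bam × A.Bam) : F :=
  (A.dmul d (A.dmul d x (A.dinv y) - A.dmul d y (A.dinv x)) s).1.1

/-- The trilinear product of the triple system associated to `B(J,Δ)` and `s`. -/
def dtform (d : F) (s y z w : A.Bam × A.Bam) : A.Bam × A.Bam :=
  (2 : F) • A.dbrace d y (A.dmul d s z) w - A.dbform d s z w • y - A.dbform d s z y • w
    - A.dbform d s y w • z

end ReducedAlbert

namespace OctonionAlgebra

open QuadraticMap

variable {F : Type u} [Field F] (O : OctonionAlgebra.{u, v} F)

/-- The polar form of the norm, as a bilinear map. -/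
def B : O.C →ₗ[F] O.C →ₗ[F] F := QuadraticMap.polarBilin O.n

lemma B_def (x y : O.C) : O.B x y = O.n (x + y) - O.n x - O.n y := rfl

lemma B_comm (x y : O.C) : O.B x y = O.B y x := QuadraticMap.polar_comm _ x y

lemma conj_eq (x : O.C) : O.conj x = O.B x 1 • (1 : O.C) - x := rfl

lemma eq_of_B {x y : O.C} (h : ∀ z, O.B x z = O.B y z) : x = y := by
  rw [← sub_eq_zero]
  refine O.nondeg _ fun z => ?_
  change O.B (x - y) z = 0
  rw [map_sub, LinearMap.sub_apply, h, sub_self]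

lemma B_one_one : O.B 1 1 = 2 := by
  have h : O.n ((1 : O.C) + 1) = 4 := by
    rw [← two_smul F (1 : O.C), QuadraticMap.map_smul, O.n_one]; norm_num
  rw [B_def, h, O.n_one]; norm_num

lemma B_mul_left (x y z : O.C) : O.B (x * y) (x * z) = O.n x * O.B y z := by
  simp only [B_def, ← mul_add, O.n_mul]; ring

lemma B_mul_right (x y z : O.C) : O.B (y * x) (z * x) = O.n x * O.B y z := by
  simp only [B_def, ← add_mul, O.n_mul]; ring

lemma B_mul_mul (x y z w : O.C) :
    O.B (x * y) (z * w) + O.B (x * w) (z * y) = O.B x z * O.B y w := by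
  have h := O.B_mul_left (x + z) y w
  have h1 := O.B_def x z
  simp only [add_mul, map_add, LinearMap.add_apply, B_mul_left] at h
  rw [O.B_comm (x * w)]
  linear_combination h - h1 * O.B y w

lemma B_adj_left (x y z : O.C) : O.B (x * y) z = O.B y (O.conj x * z) := by
  have h := O.B_mul_mul x y 1 z
  rw [one_mul, one_mul, O.B_comm _ y] at h
  rw [conj_eq, sub_mul, smul_mul_assoc, one_mul, map_sub, map_smul, smul_eq_mul]
  linear_combination h

lemma B_adj_right (x y z : O.C) : O.B (x * y) z = O.B x (z * O.conj y) := by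
  have h := O.B_mul_mul x y z 1
  rw [mul_one, mul_one] at h
  rw [conj_eq, mul_sub, mul_smul_comm, mul_one, map_sub, map_smul, smul_eq_mul]
  linear_combination h

lemma conj_one : O.conj 1 = 1 := by
  rw [conj_eq, B_one_one]; module

lemma B_conj_one (x : O.C) : O.B (O.conj x) 1 = O.B x 1 := by
  rw [conj_eq, map_sub, map_smul, LinearMap.sub_apply, LinearMap.smul_apply, B_one_one,
    smul_eq_mul]
  ring

@[simp] lemma conj_conj (x : O.C) : O.conj (O.conj x) = x := by
  rw [O.conj_eq (O.conj x), B_conj_one, conj_eq]; module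

lemma conj_mul_cancel_left (x y : O.C) : O.conj x * (x * y) = O.n x • y := by
  refine O.eq_of_B fun z => ?_
  rw [B_adj_left, conj_conj, B_mul_left, map_smul]; rfl

lemma mul_conj_cancel_right (x y : O.C) : (y * x) * O.conj x = O.n x • y := by
  refine O.eq_of_B fun z => ?_
  rw [B_adj_right, conj_conj, B_mul_right, map_smul]; rfl

lemma mul_conj_self (x : O.C) : x * O.conj x = O.n x • (1 : O.C) := by
  simpa using O.mul_conj_cancel_right x 1

lemma conj_mul_self (x : O.C) : O.conj x * x = O.n x • (1 : O.C) := by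
  simpa using O.conj_mul_cancel_left x 1

lemma mul_conj_cancel_left (x y : O.C) : x * (O.conj x * y) = O.n x • y := by
  have h := O.conj_mul_cancel_left x y
  rw [conj_eq, sub_mul, smul_mul_assoc, one_mul] at h ⊢
  rw [mul_sub, mul_smul_comm, ← h]

lemma conj_mul_cancel_right (x y : O.C) : (y * O.conj x) * x = O.n x • y := by
  have h := O.mul_conj_cancel_right x y
  rw [conj_eq, mul_sub, mul_smul_comm, mul_one] at h ⊢
  rw [sub_mul, smul_mul_assoc, ← h]

lemma B_conj (x y : O.C) : O.B (O.conj x) y = O.B x (O.conj y) := by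
  simp only [conj_eq, map_sub, map_smul, LinearMap.sub_apply, LinearMap.smul_apply, smul_eq_mul]
  rw [O.B_comm 1 y]; ring

lemma conj_mul (x y : O.C) : O.conj (x * y) = O.conj y * O.conj x := by
  refine O.eq_of_B fun z => ?_
  rw [B_conj, B_adj_left, B_adj_left, conj_conj, O.B_comm _ (y * z), B_adj_right]

lemma B_mul_one_comm (x y : O.C) : O.B (x * y) 1 = O.B (y * x) 1 := by
  rw [B_adj_left, B_adj_right, mul_one, one_mul]

lemma B_mul_one_assoc (x y z : O.C) : O.B (x * y * z) 1 = O.B (x * (y * z)) 1 := by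
  rw [B_adj_right, one_mul, B_adj_left, B_adj_left, mul_one, B_adj_right]

lemma add_conj (x : O.C) : x + O.conj x = O.B x 1 • (1 : O.C) := by
  rw [conj_eq]; module

end OctonionAlgebra

namespace ReducedAlbert

variable {F : Type u} [Field F] (A : ReducedAlbert.{u, v} F)

/-- The Jordan product as a bilinear map. -/
def jmulB : A.M →ₗ[F] A.M →ₗ[F] A.M :=
  LinearMap.mk₂ F A.jmul
    (fun x y z => by simp only [jmul, add_mul, mul_add]; module)
    (fun r x y => by simp only [jmul, smul_mul_assoc, mul_smul_comm]; module)
    (fun x y z => by simp only [jmul, add_mul, mul_add]; module)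
    (fun r x y => by simp only [jmul, smul_mul_assoc, mul_smul_comm]; module)

lemma jmul_eq (x y : A.M) : A.jmul x y = A.jmulB x y := rfl

lemma jmulB_comm (x y : A.M) : A.jmulB x y = A.jmulB y x := by
  rw [← jmul_eq, ← jmul_eq, jmul, jmul, add_comm]

lemma trace_def (x : A.M) : A.trace x = (2 : F)⁻¹ * ∑ i, A.O.B (x i i) 1 := rfl

/-- The trace as a linear form. -/
def traceL : A.M →ₗ[F] F where
  toFun := A.trace
  map_add' x y := by
    simp only [trace_def, Matrix.add_apply, map_add, LinearMap.add_apply, Finset.sum_add_distrib]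
    ring
  map_smul' r x := by
    simp only [trace_def, Matrix.smul_apply, map_smul, LinearMap.smul_apply, smul_eq_mul,
      ← Finset.mul_sum, RingHom.id_apply]
    ring

lemma trace_eq (x : A.M) : A.trace x = A.traceL x := rfl

/-- The trace form as a bilinear map. -/
def tbB : A.M →ₗ[F] A.M →ₗ[F] F := A.jmulB.compr₂ A.traceL

lemma tb_eq (x y : A.M) : A.tb x y = A.tbB x y := rfl

lemma tbB_apply (x y : A.M) : A.tbB x y = A.traceL (A.jmulB x y) := rfl

lemma tbB_comm (x y : A.M) : A.tbB x y = A.tbB y x := by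
  rw [tbB_apply, jmulB_comm, tbB_apply]

lemma traceL_mul_comm (x y : A.M) : A.traceL (x * y) = A.traceL (y * x) := by
  simp only [← trace_eq, trace_def, Matrix.mul_apply, map_sum, LinearMap.sum_apply]
  rw [Finset.sum_comm]
  simp only [A.O.B_mul_one_comm (x _ _)]

lemma traceL_mul_assoc (x y z : A.M) : A.traceL (x * y * z) = A.traceL (x * (y * z)) := by
  simp only [← trace_eq, trace_def, Matrix.mul_apply, map_sum, LinearMap.sum_apply,
    Finset.sum_mul, Finset.mul_sum, A.O.B_mul_one_assoc]
  exact Finset.sum_congr rfl fun i _ => Finset.sum_comm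

lemma jmulB_apply (x y : A.M) : A.jmulB x y = (2 : F)⁻¹ • (x * y + y * x) := rfl

lemma tbB_eq_mul (h2 : (2 : F) ≠ 0) (x y : A.M) : A.tbB x y = A.traceL (x * y) := by
  rw [tbB_apply, jmulB_apply, map_smul, map_add, A.traceL_mul_comm y x, smul_eq_mul]
  field_simp; ring

lemma tbB_assoc (h2 : (2 : F) ≠ 0) (x y z : A.M) :
    A.tbB (A.jmulB x y) z = A.tbB x (A.jmulB y z) := by
  rw [A.tbB_eq_mul h2, A.tbB_eq_mul h2]
  simp only [jmulB_apply, smul_mul_assoc, mul_smul_comm, add_mul, mul_add, map_smul, map_add]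
  rw [A.traceL_mul_assoc x y z, A.traceL_mul_assoc y x z, A.traceL_mul_comm y,
    A.traceL_mul_assoc x z y]

lemma jmulB_one (h2 : (2 : F) ≠ 0) (x : A.M) : A.jmulB x 1 = x := by
  rw [jmulB_apply, mul_one, one_mul, ← two_smul F x, smul_smul, inv_mul_cancel₀ h2, one_smul]

lemma tbB_one (h2 : (2 : F) ≠ 0) (x : A.M) : A.tbB x 1 = A.traceL x := by
  rw [tbB_apply, jmulB_one A h2]

lemma traceL_one (h2 : (2 : F) ≠ 0) : A.traceL 1 = 3 := by
  simp only [← trace_eq, trace_def, Matrix.one_apply_eq, OctonionAlgebra.B_one_one,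
    Finset.sum_const, Finset.card_univ, Fintype.card_fin]
  field_simp; norm_num

lemma sharp_eq (x : A.M) : A.sharp x = A.jmulB x x - A.traceL x • x
    + ((2 : F)⁻¹ * (A.traceL x ^ 2 - A.tbB x x)) • (1 : A.M) := rfl

lemma cross_apply (h2 : (2 : F) ≠ 0) (x y : A.M) : A.cross x y =
    (2 : F) • A.jmulB x y - A.traceL x • y - A.traceL y • x
      + (A.traceL x * A.traceL y - A.tbB x y) • (1 : A.M) := by
  simp only [cross, sharp_eq, map_add, LinearMap.add_apply]
  rw [A.jmulB_comm y x, A.tbB_comm y x]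
  match_scalars <;> field_simp <;> ring

end ReducedAlbert

namespace ReducedAlbert

variable {F : Type u} [Field F] (A : ReducedAlbert.{u, v} F)

/-- The Freudenthal cross product as a bilinear map. -/
def crossB (h2 : (2 : F) ≠ 0) : A.M →ₗ[F] A.M →ₗ[F] A.M :=
  LinearMap.mk₂ F A.cross
    (fun x y z => by
      simp only [A.cross_apply h2, map_add, LinearMap.add_apply]; module)
    (fun r x y => by
      simp only [A.cross_apply h2, map_smul, LinearMap.smul_apply, smul_eq_mul]; module)
    (fun x y z => by
      simp only [A.cross_apply h2, map_add]; module)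
    (fun r x y => by
      simp only [A.cross_apply h2, map_smul, smul_eq_mul]; module)

variable {A} (h2 : (2 : F) ≠ 0)

lemma cross_eq (x y : A.M) : A.cross x y = A.crossB h2 x y := rfl

lemma crossB_apply (x y : A.M) : A.crossB h2 x y =
    (2 : F) • A.jmulB x y - A.traceL x • y - A.traceL y • x
      + (A.traceL x * A.traceL y - A.tbB x y) • (1 : A.M) := A.cross_apply h2 x y

lemma crossB_comm (x y : A.M) : A.crossB h2 x y = A.crossB h2 y x := by
  rw [crossB_apply, crossB_apply, A.jmulB_comm y x, A.tbB_comm y x]; module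

lemma crossB_one (x : A.M) : A.crossB h2 x 1 = A.traceL x • (1 : A.M) - x := by
  rw [crossB_apply, A.jmulB_one h2, A.traceL_one h2, A.tbB_one h2]; module

lemma one_crossB (x : A.M) : A.crossB h2 1 x = A.traceL x • (1 : A.M) - x := by
  rw [crossB_comm, crossB_one]

lemma tbB_crossB_left (x y z : A.M) :
    A.tbB (A.crossB h2 x y) z = A.tbB x (A.crossB h2 y z) := by
  simp only [crossB_apply, map_add, map_sub, map_smul, LinearMap.add_apply, LinearMap.sub_apply,
    LinearMap.smul_apply, smul_eq_mul, A.tbB_assoc h2, A.tbB_one h2, A.tbB_comm 1]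
  ring

lemma traceL_crossB (x y : A.M) :
    A.traceL (A.crossB h2 x y) = A.traceL x * A.traceL y - A.tbB x y := by
  rw [← A.tbB_one h2, tbB_crossB_left, crossB_one, map_sub, map_smul, A.tbB_one h2, smul_eq_mul]
  ring

include h2 in
lemma diag_of_mem {x : A.M} (hx : x ∈ A.J) (i : Fin 3) : ∃ e : F, x i i = e • (1 : A.O.C) := by
  refine ⟨2⁻¹ * A.O.B (x i i) 1, ?_⟩
  have h : x i i = A.O.conj (x i i) := by
    have h := hx i i
    rwa [inv_mul_cancel₀ (A.γ i).ne_zero, one_smul] at h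
  have h' := A.O.add_conj (x i i)
  rw [← h, ← two_smul F] at h'
  rw [mul_smul, ← h', smul_smul, inv_mul_cancel₀ h2, one_smul]

lemma mul_transpose_of_mem {x : A.M} (hx : x ∈ A.J) (i j : Fin 3) :
    ∃ n : F, (x i j * x j i = n • (1 : A.O.C) ∧ x j i * x i j = n • (1 : A.O.C)) ∧
      (∀ y, x i j * (x j i * y) = n • y) ∧ (∀ y, x j i * (x i j * y) = n • y) ∧
      (∀ y, y * x i j * x j i = n • y) ∧ (∀ y, y * x j i * x i j = n • y) := by
  refine ⟨(A.γ j : F)⁻¹ * (A.γ i : F) * A.O.n (x i j), ?_⟩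
  rw [hx j i]
  simp only [smul_mul_assoc, mul_smul_comm, OctonionAlgebra.mul_conj_self,
    OctonionAlgebra.conj_mul_self, OctonionAlgebra.mul_conj_cancel_left,
    OctonionAlgebra.conj_mul_cancel_left, OctonionAlgebra.mul_conj_cancel_right,
    OctonionAlgebra.conj_mul_cancel_right, smul_smul]
  simp

lemma cycle_of_mem {x : A.M} (hx : x ∈ A.J) (i j k : Fin 3) :
    x i j * (x j k * x k i) + x i k * x k j * x j i
      = A.O.B (x i j * (x j k * x k i)) 1 • (1 : A.O.C) := by
  rw [← A.O.add_conj, A.O.conj_mul, A.O.conj_mul, hx i k, hx k j, hx j i]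
  simp only [smul_mul_assoc, mul_smul_comm, smul_smul]
  have hi := (A.γ i).ne_zero
  have hj := (A.γ j).ne_zero
  have hk := (A.γ k).ne_zero
  congr 1
  convert one_smul F _ using 2
  field_simp

lemma cycle_trace_swap {x : A.M} (hx : x ∈ A.J) (i j k : Fin 3) :
    A.O.B (x i k * (x k j * x j i)) 1 = A.O.B (x i j * (x j k * x k i)) 1 := by
  have h := congrArg (fun y => A.O.B y 1) (cycle_of_mem hx i j k)
  simp only [map_add, map_smul, LinearMap.add_apply, LinearMap.smul_apply,
    OctonionAlgebra.B_one_one, smul_eq_mul, A.O.B_mul_one_assoc] at h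
  linear_combination h

lemma cycle_trace_rotate (x : A.M) (i j k : Fin 3) :
    A.O.B (x j k * (x k i * x i j)) 1 = A.O.B (x i j * (x j k * x k i)) 1 := by
  rw [← A.O.B_mul_one_assoc, A.O.B_mul_one_comm]

include h2 in
/-- The Cayley-Hamilton equation of degree three in a reduced Albert algebra. -/
lemma jmulB_jmulB_self {x : A.M} (hx : x ∈ A.J) : ∃ r : F,
    (2 : F) • A.jmulB x (A.jmulB x x) = (2 * A.traceL x) • A.jmulB x x
      - (A.traceL x ^ 2 - A.tbB x x) • x + r • (1 : A.M) := by
  obtain ⟨e0, h0⟩ := diag_of_mem h2 hx 0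
  obtain ⟨e1, h1⟩ := diag_of_mem h2 hx 1
  obtain ⟨e2, h2'⟩ := diag_of_mem h2 hx 2
  obtain ⟨n0, ⟨m0, m0'⟩, l0, l0', r0, r0'⟩ := mul_transpose_of_mem hx 1 2
  obtain ⟨n1, ⟨m1, m1'⟩, l1, l1', r1, r1'⟩ := mul_transpose_of_mem hx 2 0
  obtain ⟨n2, ⟨m2, m2'⟩, l2, l2', r2, r2'⟩ := mul_transpose_of_mem hx 0 1
  have hsq : A.jmulB x x = x * x := by
    rw [A.jmulB_apply, ← two_smul F (x * x), smul_smul, inv_mul_cancel₀ h2, one_smul]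
  have ht : A.traceL x = e0 + e1 + e2 := by
    rw [← trace_eq, trace_def, Fin.sum_univ_three, h0, h1, h2']
    simp only [map_smul, LinearMap.smul_apply, OctonionAlgebra.B_one_one, smul_eq_mul]
    field_simp
  have htt : A.tbB x x = e0 ^ 2 + e1 ^ 2 + e2 ^ 2 + 2 * (n0 + n1 + n2) := by
    rw [tbB_apply, hsq, ← trace_eq, trace_def, Fin.sum_univ_three]
    simp only [Matrix.mul_apply, Fin.sum_univ_three, h0, h1, h2', m0, m0', m1, m1', m2, m2',
      map_add, map_smul, LinearMap.add_apply, mul_smul_comm, mul_one,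
      LinearMap.smul_apply, OctonionAlgebra.B_one_one, smul_eq_mul]
    field_simp
    ring
  set s := A.O.B (x 0 1 * (x 1 2 * x 2 0)) 1 with hs
  have c0 := cycle_of_mem hx 0 1 2
  have c0' := cycle_of_mem hx 0 2 1
  have c1 := cycle_of_mem hx 1 2 0
  have c1' := cycle_of_mem hx 1 0 2
  have c2 := cycle_of_mem hx 2 0 1
  have c2' := cycle_of_mem hx 2 1 0
  rw [cycle_trace_swap hx 0 1 2, ← hs] at c0'
  rw [cycle_trace_rotate, ← hs] at c1
  rw [cycle_trace_swap hx 1 2 0, cycle_trace_rotate, ← hs] at c1'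
  rw [cycle_trace_rotate, cycle_trace_rotate, ← hs] at c2
  rw [cycle_trace_swap hx 2 0 1, cycle_trace_rotate, cycle_trace_rotate, ← hs] at c2'
  refine ⟨2 * (e0 * e1 * e2 - e0 * n0 - e1 * n1 - e2 * n2 + s), ?_⟩
  rw [hsq, A.jmulB_apply, smul_smul, mul_inv_cancel₀ h2, one_smul, ht, htt]
  ext i j
  fin_cases i <;> fin_cases j <;>
  simp only [Matrix.add_apply, Matrix.sub_apply, Matrix.smul_apply, Matrix.mul_apply,
    Fin.sum_univ_three, Matrix.one_apply, Fin.zero_eta, Fin.mk_one, Fin.reduceFinMk, Fin.isValue,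
    Fin.reduceEq, if_true, if_false, h0, h1, h2', mul_add, add_mul,
    smul_mul_assoc, mul_smul_comm, one_mul, mul_one, smul_zero, m0, m0', m1, m1', m2, m2',
    l0, l0', l1, l1', l2, l2', r0, r0', r1, r1', r2, r2', zero_ne_one, one_ne_zero]
  · linear_combination (norm := module) c0 + c0'
  · module
  · module
  · module
  · linear_combination (norm := module) c1 + c1'
  · module
  · module
  · module
  · linear_combination (norm := module) c2 + c2'

end ReducedAlbert

namespace ReducedAlbert

variable {F : Type u} [Field F] {A : ReducedAlbert.{u, v} F} (h2 : (2 : F) ≠ 0)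

lemma crossB_crossB_self {x : A.M} (hx : x ∈ A.J) :
    (3 : F) • A.crossB h2 x (A.crossB h2 x x) = -(3 * A.traceL x) • A.crossB h2 x x
      - (3 * A.traceL (A.crossB h2 x x)) • x
      + (3 * A.traceL x * A.traceL (A.crossB h2 x x) - A.tbB x (A.crossB h2 x x)) •
        (1 : A.M) := by
  obtain ⟨r, hr⟩ := jmulB_jmulB_self h2 hx
  have key : A.crossB h2 x (A.crossB h2 x x) = -A.traceL x • A.crossB h2 x x
      - A.traceL (A.crossB h2 x x) • x + (2 * r + A.traceL x * A.traceL (A.crossB h2 x x)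
        - A.tbB x (A.crossB h2 x x)) • (1 : A.M) := by
    have hj : A.jmulB x (A.crossB h2 x x) = r • (1 : A.M) := by
      rw [crossB_apply]
      simp only [map_add, map_sub, map_smul, A.jmulB_one h2]
      linear_combination (norm := module) hr
    rw [crossB_apply h2 x (A.crossB h2 x x), hj]
    module
  have ht := congrArg A.traceL key
  rw [traceL_crossB] at ht
  simp only [map_add, map_sub, map_smul, A.traceL_one h2, smul_eq_mul] at ht
  rw [key]
  linear_combination (norm := module) -ht • (1 : A.M)

/-- The linearization of the Cayley-Hamilton equation. -/
lemma crossB_crossB_linearized (h3 : (3 : F) ≠ 0) {x y : A.M} (hx : x ∈ A.J) (hy : y ∈ A.J) :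
    A.crossB h2 y (A.crossB h2 x x) + (2 : F) • A.crossB h2 x (A.crossB h2 x y)
      = -A.traceL y • A.crossB h2 x x - (2 * A.traceL x) • A.crossB h2 x y
      - A.traceL (A.crossB h2 x x) • y - (2 * A.traceL (A.crossB h2 x y)) • x
      + (A.traceL y * A.traceL (A.crossB h2 x x) + 2 * A.traceL x * A.traceL (A.crossB h2 x y)
        - A.tbB y (A.crossB h2 x x)) • (1 : A.M) := by
  have hp := crossB_crossB_self h2 (A.J.add_mem hx hy)
  have hm := crossB_crossB_self h2 (A.J.sub_mem hx hy)
  have h0 := crossB_crossB_self h2 hy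
  have e : A.tbB x (A.crossB h2 x y) = A.tbB y (A.crossB h2 x x) := by
    rw [A.tbB_comm y, tbB_crossB_left]
  have h6 : (6 : F) ≠ 0 := by
    rw [show (6 : F) = 2 * 3 by norm_num]; exact mul_ne_zero h2 h3
  simp only [map_add, map_sub, LinearMap.add_apply, LinearMap.sub_apply,
    crossB_comm h2 y x, e] at hp hm
  refine smul_right_injective _ h6 ?_
  linear_combination (norm := module) hp - hm - (2 : F) • h0

/-- The product of the Brown algebra `B(J, F×F)` as a bilinear map. -/
def bmulB (h2 : (2 : F) ≠ 0) : A.Bam →ₗ[F] A.Bam →ₗ[F] A.Bam :=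
  LinearMap.mk₂ F (A.bmul 1)
    (fun x y z => by
      ext1
      · simp only [bmul, tb_eq, Prod.fst_add, Prod.snd_add, map_add, LinearMap.add_apply]; ring
      ext1
      · simp only [bmul, cross_eq h2, Prod.fst_add, Prod.snd_add, map_add, LinearMap.add_apply]
        module
      ext1
      · simp only [bmul, cross_eq h2, Prod.fst_add, Prod.snd_add, map_add, LinearMap.add_apply]
        module
      · simp only [bmul, tb_eq, Prod.fst_add, Prod.snd_add, map_add]; ring)
    (fun r x z => by
      ext1
      · simp only [bmul, tb_eq, Prod.smul_fst, Prod.smul_snd, map_smul, LinearMap.smul_apply,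
          smul_eq_mul]
        ring
      ext1
      · simp only [bmul, cross_eq h2, Prod.smul_fst, Prod.smul_snd, map_smul,
          LinearMap.smul_apply, smul_eq_mul]
        module
      ext1
      · simp only [bmul, cross_eq h2, Prod.smul_fst, Prod.smul_snd, map_smul,
          LinearMap.smul_apply, smul_eq_mul]
        module
      · simp only [bmul, tb_eq, Prod.smul_fst, Prod.smul_snd, map_smul, smul_eq_mul]; ring)
    (fun x y z => by
      ext1
      · simp only [bmul, tb_eq, Prod.fst_add, Prod.snd_add, map_add]; ring
      ext1
      · simp only [bmul, cross_eq h2, Prod.fst_add, Prod.snd_add, map_add]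
        module
      ext1
      · simp only [bmul, cross_eq h2, Prod.fst_add, Prod.snd_add, map_add]
        module
      · simp only [bmul, tb_eq, Prod.fst_add, Prod.snd_add, map_add, LinearMap.add_apply]; ring)
    (fun r x z => by
      ext1
      · simp only [bmul, tb_eq, Prod.smul_fst, Prod.smul_snd, map_smul, smul_eq_mul]
        ring
      ext1
      · simp only [bmul, cross_eq h2, Prod.smul_fst, Prod.smul_snd, map_smul, smul_eq_mul]
        module
      ext1
      · simp only [bmul, cross_eq h2, Prod.smul_fst, Prod.smul_snd, map_smul, smul_eq_mul]
        module
      · simp only [bmul, tb_eq, Prod.smul_fst, Prod.smul_snd, map_smul, LinearMap.smul_apply,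
          smul_eq_mul]
        ring)

lemma bmul_eq (x y : A.Bam) : A.bmul 1 x y = bmulB h2 x y := rfl

variable (A) in
/-- The involution of the Brown algebra as a linear map. -/
def binvL : A.Bam →ₗ[F] A.Bam where
  toFun := A.binv
  map_add' _ _ := rfl
  map_smul' _ _ := rfl

lemma binv_eq (x : A.Bam) : A.binv x = A.binvL x := rfl

lemma bform_apply (x y : A.Bam) : A.bform 1 x y
    = x.1 * y.2.2.2 + A.tbB x.2.1 y.2.2.1 - y.1 * x.2.2.2 - A.tbB y.2.1 x.2.2.1 := by
  simp only [bform, bformS, bmul, binv, s0, tb_eq, Prod.fst_sub, Prod.snd_sub, map_zero]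
  ring

lemma bformS_s0 (x y : A.Bam) : A.bformS 1 A.s0 x y = A.bform 1 x y := rfl

lemma bformS_smul (c : F) (x y : A.Bam) : A.bformS 1 (c • A.s0) x y = c * A.bform 1 x y := by
  simp only [bform, bformS, bmul, Prod.smul_fst, Prod.smul_snd, tb_eq, map_smul, smul_eq_mul]
  ring

include h2 in
lemma tformS_smul (c : F) (x y z : A.Bam) :
    A.tformS 1 (c • A.s0) x y z = c • A.tform 1 x y z := by
  simp only [tform, tformS, bformS_smul, bformS_s0, brace, bmul_eq h2, binv_eq, map_smul,
    LinearMap.smul_apply]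
  module

/-- The trilinear product of the triple system of `B(J, F×F)` in coordinates; all the
components are visibly symmetric in the three arguments. -/
lemma tform_apply (x y z : A.Bam) : A.tform 1 x y z =
    (-2 * (x.1 * y.1 * z.2.2.2 + x.1 * y.2.2.2 * z.1 + x.2.2.2 * y.1 * z.1)
      + x.1 * (A.tbB y.2.1 z.2.2.1 + A.tbB z.2.1 y.2.2.1)
      + y.1 * (A.tbB x.2.1 z.2.2.1 + A.tbB z.2.1 x.2.2.1)
      + z.1 * (A.tbB x.2.1 y.2.2.1 + A.tbB y.2.1 x.2.2.1)
      - 2 * A.tbB (A.crossB h2 x.2.2.1 y.2.2.1) z.2.2.1,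
     (x.1 * y.2.2.2 + x.2.2.2 * y.1 - A.tbB x.2.1 y.2.2.1 - A.tbB y.2.1 x.2.2.1) • z.2.1
      + (x.1 * z.2.2.2 + x.2.2.2 * z.1 - A.tbB x.2.1 z.2.2.1 - A.tbB z.2.1 x.2.2.1) • y.2.1
      + (y.1 * z.2.2.2 + y.2.2.2 * z.1 - A.tbB y.2.1 z.2.2.1 - A.tbB z.2.1 y.2.2.1) • x.2.1
      - (2 : F) • (x.2.2.2 • A.crossB h2 y.2.2.1 z.2.2.1 + y.2.2.2 • A.crossB h2 x.2.2.1 z.2.2.1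
        + z.2.2.2 • A.crossB h2 x.2.2.1 y.2.2.1)
      + (2 : F) • (A.crossB h2 z.2.2.1 (A.crossB h2 x.2.1 y.2.1)
        + A.crossB h2 y.2.2.1 (A.crossB h2 x.2.1 z.2.1)
        + A.crossB h2 x.2.2.1 (A.crossB h2 y.2.1 z.2.1)),
     -((x.1 * y.2.2.2 + x.2.2.2 * y.1 - A.tbB x.2.1 y.2.2.1 - A.tbB y.2.1 x.2.2.1) • z.2.2.1
      + (x.1 * z.2.2.2 + x.2.2.2 * z.1 - A.tbB x.2.1 z.2.2.1 - A.tbB z.2.1 x.2.2.1) • y.2.2.1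
      + (y.1 * z.2.2.2 + y.2.2.2 * z.1 - A.tbB y.2.1 z.2.2.1 - A.tbB z.2.1 y.2.2.1) • x.2.2.1)
      + (2 : F) • (x.1 • A.crossB h2 y.2.1 z.2.1 + y.1 • A.crossB h2 x.2.1 z.2.1
        + z.1 • A.crossB h2 x.2.1 y.2.1)
      - (2 : F) • (A.crossB h2 z.2.1 (A.crossB h2 x.2.2.1 y.2.2.1)
        + A.crossB h2 y.2.1 (A.crossB h2 x.2.2.1 z.2.2.1)
        + A.crossB h2 x.2.1 (A.crossB h2 y.2.2.1 z.2.2.1)),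
     2 * (x.2.2.2 * y.2.2.2 * z.1 + x.2.2.2 * y.1 * z.2.2.2 + x.1 * y.2.2.2 * z.2.2.2)
      - x.2.2.2 * (A.tbB y.2.1 z.2.2.1 + A.tbB z.2.1 y.2.2.1)
      - y.2.2.2 * (A.tbB x.2.1 z.2.2.1 + A.tbB z.2.1 x.2.2.1)
      - z.2.2.2 * (A.tbB x.2.1 y.2.2.1 + A.tbB y.2.1 x.2.2.1)
      + 2 * A.tbB (A.crossB h2 x.2.1 y.2.1) z.2.1) := by
  obtain ⟨a, j, j', b⟩ := x
  obtain ⟨c, k, k', d⟩ := y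
  obtain ⟨e, l, l', f⟩ := z
  have hT : ∀ p q r : A.M, A.tbB r (A.crossB h2 p q) = A.tbB (A.crossB h2 p q) r :=
    fun p q r => A.tbB_comm _ _
  have hL : ∀ p q r : A.M, A.tbB (A.crossB h2 p q) r = A.tbB (A.crossB h2 p r) q :=
    fun p q r => by rw [tbB_crossB_left, tbB_crossB_left, crossB_comm]
  have hC : ∀ p q r : A.M, A.crossB h2 (A.crossB h2 p q) r = A.crossB h2 r (A.crossB h2 p q) :=
    fun p q r => crossB_comm h2 _ _
  simp only [tform, tformS, bformS_s0, bform_apply]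
  ext1
  · simp only [brace, bmul, binv, s0, tb_eq, cross_eq h2, map_add, map_smul,
      LinearMap.add_apply, LinearMap.smul_apply, Prod.fst_add,
      Prod.fst_sub, Prod.smul_fst, smul_eq_mul, map_zero,
      LinearMap.zero_apply, smul_zero, hT]
    rw [crossB_comm h2 l' k', hL k' l' j', crossB_comm h2 k' j', crossB_comm h2 l' j', hL j' l' k']
    ring
  ext1
  · simp only [brace, bmul, binv, s0, tb_eq, cross_eq h2, map_add, map_smul,
      LinearMap.add_apply, LinearMap.smul_apply, Prod.fst_add, Prod.snd_add,
      Prod.fst_sub, Prod.snd_sub, Prod.smul_fst, Prod.smul_snd, smul_eq_mul, map_zero,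
      LinearMap.zero_apply, smul_zero, hC, crossB_comm h2 k j, crossB_comm h2 l j,
      crossB_comm h2 l k, crossB_comm h2 k' j', crossB_comm h2 l' j', crossB_comm h2 l' k']
    module
  ext1
  · simp only [brace, bmul, binv, s0, tb_eq, cross_eq h2, map_add, map_smul,
      LinearMap.add_apply, LinearMap.smul_apply, Prod.fst_add, Prod.snd_add,
      Prod.fst_sub, Prod.snd_sub, Prod.smul_fst, Prod.smul_snd, smul_eq_mul, map_zero,
      LinearMap.zero_apply, smul_zero, hC, crossB_comm h2 k j, crossB_comm h2 l j,
      crossB_comm h2 l k, crossB_comm h2 k' j', crossB_comm h2 l' j', crossB_comm h2 l' k']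
    module
  · simp only [brace, bmul, binv, s0, tb_eq, cross_eq h2, map_add, map_smul,
      LinearMap.add_apply, LinearMap.smul_apply, Prod.snd_add,
      Prod.snd_sub, Prod.smul_snd, smul_eq_mul, map_zero,
      LinearMap.zero_apply, smul_zero, hT]
    rw [crossB_comm h2 l k, hL k l j, crossB_comm h2 k j, crossB_comm h2 l j, hL j l k]
    ring

end ReducedAlbert

namespace ReducedAlbert

variable {F : Type u} [Field F] {A : ReducedAlbert.{u, v} F} (h2 : (2 : F) ≠ 0)

include h2

lemma tform_comm_left (x y z : A.Bam) : A.tform 1 x y z = A.tform 1 y x z := by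
  rw [tform_apply h2, tform_apply h2]
  simp only [crossB_comm h2 y.2.1 x.2.1, crossB_comm h2 y.2.2.1 x.2.2.1]
  ext1
  · ring
  ext1
  · module
  ext1
  · module
  · ring

lemma tform_comm_right (x y z : A.Bam) : A.tform 1 x y z = A.tform 1 x z y := by
  have hL : ∀ p q r : A.M, A.tbB (A.crossB h2 p q) r = A.tbB (A.crossB h2 p r) q :=
    fun p q r => by rw [tbB_crossB_left, tbB_crossB_left, crossB_comm]
  rw [tform_apply h2, tform_apply h2]
  simp only [crossB_comm h2 z.2.1 y.2.1, crossB_comm h2 z.2.2.1 y.2.2.1,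
    hL x.2.1 z.2.1, hL x.2.2.1 z.2.2.1]
  ext1
  · ring
  ext1
  · module
  ext1
  · module
  · ring

lemma tform_add_left (x x' y z : A.Bam) :
    A.tform 1 (x + x') y z = A.tform 1 x y z + A.tform 1 x' y z := by
  have hb : ∀ y, A.bform 1 (x + x') y = A.bform 1 x y + A.bform 1 x' y := fun y => by
    simp only [bform_apply, Prod.fst_add, Prod.snd_add, map_add, LinearMap.add_apply]; ring
  have hb' : ∀ y, A.bform 1 y (x + x') = A.bform 1 y x + A.bform 1 y x' := fun y => by
    simp only [bform_apply, Prod.fst_add, Prod.snd_add, map_add, LinearMap.add_apply]; ring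
  simp only [tform, tformS, bformS_s0, hb, hb', brace, bmul_eq h2, binv_eq, map_add,
    LinearMap.add_apply]
  module

omit h2 in
lemma mem_Dsub {p : A.Bam × A.Bam} : p ∈ A.Dsub ↔ ∃ (a b : F) (j k : A.M),
    j ∈ A.J ∧ k ∈ A.J ∧ p = ((a, j, j, a), (b, k, -k, -b)) := by
  constructor
  · obtain ⟨⟨a, j, j', a'⟩, ⟨b, k, k', b'⟩⟩ := p
    rintro ⟨⟨hj, -⟩, ⟨hk, -⟩, h, h'⟩
    simp only [varpi, Prod.mk.injEq, Prod.neg_mk] at h h'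
    exact ⟨a, b, j, k, hj, hk, by rw [h.1, h.2.1, h'.1, h'.2.1]⟩
  · rintro ⟨a, b, j, k, hj, hk, rfl⟩
    exact ⟨⟨hj, hj⟩, ⟨hk, A.J.neg_mem hk⟩, rfl, by simp [varpi]⟩

omit h2 in
lemma bform_fst_eq_zero {x y : A.Bam × A.Bam} (hx : x ∈ A.Dsub) (hy : y ∈ A.Dsub) :
    A.bform 1 x.1 y.1 = 0 := by
  obtain ⟨a, b, j, k, -, -, rfl⟩ := mem_Dsub.1 hx
  obtain ⟨a', b', j', k', -, -, rfl⟩ := mem_Dsub.1 hy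
  rw [bform_apply]
  linear_combination A.tbB_comm j j'

omit h2 in
lemma bform_snd_eq_zero {x y : A.Bam × A.Bam} (hx : x ∈ A.Dsub) (hy : y ∈ A.Dsub) :
    A.bform 1 x.2 y.2 = 0 := by
  obtain ⟨a, b, j, k, -, -, rfl⟩ := mem_Dsub.1 hx
  obtain ⟨a', b', j', k', -, -, rfl⟩ := mem_Dsub.1 hy
  rw [bform_apply]
  simp only [map_neg]
  linear_combination -A.tbB_comm k k'

lemma dbform_apply (d c : F) (x y : A.Bam × A.Bam) :
    A.dbform d (c • A.ds0) x y = c * (d * (A.bform 1 x.1 y.2 + A.bform 1 x.2 y.1)) := by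
  simp only [dbform, dmul, dinv, ds0, bform, bformS, Prod.smul_fst, Prod.smul_snd, Prod.fst_sub,
    Prod.snd_sub, bmul_eq h2, map_add, map_sub, map_smul, LinearMap.add_apply,
    LinearMap.sub_apply, smul_zero, map_zero, Prod.fst_add, Prod.fst_zero, smul_eq_mul]
  ring

/-- The trilinear product of `B(J, Δ)` is the extension of scalars of the one of `B(J, F × F)`,
multiplied by the generator `δ` of `Δ`. -/
lemma dtform_apply (d c : F) {x y z : A.Bam × A.Bam} (hx : x ∈ A.Dsub) (hy : y ∈ A.Dsub)
    (hz : z ∈ A.Dsub) : A.dtform d (c • A.ds0) x y z =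
      c • (d • (A.tform 1 x.1 y.1 z.2 + A.tform 1 x.1 y.2 z.1 + A.tform 1 x.2 y.1 z.1
          + d • A.tform 1 x.2 y.2 z.2),
        A.tform 1 x.1 y.1 z.1 + d • (A.tform 1 x.1 y.2 z.2 + A.tform 1 x.2 y.1 z.2
          + A.tform 1 x.2 y.2 z.1)) := by
  simp only [dtform, dbform_apply h2]
  ext1 <;>
  · simp only [tform, tformS, bformS_s0, bform_fst_eq_zero hy hz,
      bform_fst_eq_zero hy hx, bform_fst_eq_zero hx hz, bform_snd_eq_zero hy hz,
      bform_snd_eq_zero hy hx, bform_snd_eq_zero hx hz, dbrace, dmul, dinv, ds0, brace,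
      bmul_eq h2, binv_eq, Prod.smul_fst, Prod.smul_snd, Prod.fst_sub, Prod.snd_sub,
      Prod.fst_add, Prod.snd_add, map_add, map_smul, LinearMap.add_apply,
      LinearMap.smul_apply, smul_zero, map_zero, LinearMap.zero_apply]
    module

variable (A) in
omit h2 in
/-- The similarity from `B(J, Δ)` to `B(J, F × F)`, where `Δ = F(√d)`. It is a form of the action
on `B(J, F × F)` of the matrix with rows `(1, √d)` and `(1, -√d)` in `GL₂(Δ)`. -/
def descent (d : F) : (A.Bam × A.Bam) →ₗ[F] A.Bam where
  toFun p := (p.1.1 + A.traceL p.1.2.1, d • ((p.1.1 - A.traceL p.1.2.1) • 1 + (2 : F) • p.1.2.1),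
    d • ((p.2.1 - A.traceL p.2.2.1) • 1 + (2 : F) • p.2.2.1), d ^ 2 * (p.2.1 + A.traceL p.2.2.1))
  map_add' p q := by
    simp only [Prod.fst_add, Prod.snd_add, map_add, Prod.mk_add_mk, Prod.mk.injEq]
    refine ⟨?_, ?_, ?_, ?_⟩
    · ring
    · module
    · module
    · ring
  map_smul' r p := by
    simp only [Prod.smul_fst, Prod.smul_snd, map_smul, Prod.smul_mk, Prod.mk.injEq, smul_eq_mul,
      RingHom.id_apply]
    refine ⟨?_, ?_, ?_, ?_⟩
    · ring
    · module
    · module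
    · ring

omit h2 in
lemma descent_apply (d : F) (p : A.Bam × A.Bam) : A.descent d p = (p.1.1 + A.traceL p.1.2.1,
    d • ((p.1.1 - A.traceL p.1.2.1) • 1 + (2 : F) • p.1.2.1),
    d • ((p.2.1 - A.traceL p.2.2.1) • 1 + (2 : F) • p.2.2.1),
    d ^ 2 * (p.2.1 + A.traceL p.2.2.1)) := rfl

lemma bform_descent (d : F) {x y : A.Bam × A.Bam} (hx : x ∈ A.Dsub) (hy : y ∈ A.Dsub) :
    A.bform 1 (A.descent d x) (A.descent d y)
      = -2 * d * (d * (A.bform 1 x.1 y.2 + A.bform 1 x.2 y.1)) := by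
  obtain ⟨a, b, j, k, -, -, rfl⟩ := mem_Dsub.1 hx
  obtain ⟨a', b', j', k', -, -, rfl⟩ := mem_Dsub.1 hy
  simp only [descent_apply, bform_apply, map_add, map_smul, map_neg, LinearMap.add_apply,
    LinearMap.smul_apply, smul_eq_mul, A.tbB_one h2, A.tbB_comm 1, A.traceL_one h2]
  rw [A.tbB_comm k j', A.tbB_comm k' j]
  ring

lemma tform_descent_self (h3 : (3 : F) ≠ 0) (d : F) {x : A.Bam × A.Bam} (hx : x ∈ A.Dsub) :
    A.tform 1 (A.descent d x) (A.descent d x) (A.descent d x) =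
      (-2 * d) • A.descent d
        (d • (A.tform 1 x.1 x.1 x.2 + A.tform 1 x.1 x.2 x.1 + A.tform 1 x.2 x.1 x.1
          + d • A.tform 1 x.2 x.2 x.2),
        A.tform 1 x.1 x.1 x.1 + d • (A.tform 1 x.1 x.2 x.2 + A.tform 1 x.2 x.1 x.2
          + A.tform 1 x.2 x.2 x.1)) := by
  rw [tform_comm_right h2 x.1 x.2 x.1, tform_comm_left h2 x.2 x.1 x.1,
    tform_comm_right h2 x.1 x.2 x.1, tform_comm_left h2 x.2 x.1 x.2,
    tform_comm_right h2 x.2 x.2 x.1, tform_comm_left h2 x.2 x.1 x.2]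
  obtain ⟨a, b, j, k, hj, hk, rfl⟩ := mem_Dsub.1 hx
  have hjk := crossB_crossB_linearized h2 h3 hj hk
  have hkj := crossB_crossB_linearized h2 h3 hk hj
  have hjj := crossB_crossB_self h2 hj
  have hkk := crossB_crossB_self h2 hk
  have e1 : A.tbB (A.crossB h2 j k) j = A.tbB (A.crossB h2 j j) k := by
    rw [tbB_crossB_left, crossB_comm, ← tbB_crossB_left]
  have e2 : A.tbB (A.crossB h2 j k) k = A.tbB (A.crossB h2 k k) j := by
    rw [crossB_comm, tbB_crossB_left, crossB_comm, ← tbB_crossB_left]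
  have hT : ∀ p q r : A.M, A.tbB r (A.crossB h2 p q) = A.tbB (A.crossB h2 p q) r :=
    fun p q r => A.tbB_comm _ _
  simp only [crossB_comm h2 k j, traceL_crossB, hT] at hjk hkj hjj hkk
  simp only [tform_apply h2, descent_apply, map_add, map_sub, map_smul, map_neg,
    LinearMap.add_apply, LinearMap.sub_apply, LinearMap.smul_apply, LinearMap.neg_apply,
    smul_eq_mul, A.tbB_one h2, A.tbB_comm 1, A.traceL_one h2, crossB_one, one_crossB,
    crossB_comm h2 k j, traceL_crossB, hT, e1, e2, A.tbB_comm k j,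
    Prod.fst_add, Prod.snd_add, Prod.smul_fst, Prod.smul_snd, Prod.smul_mk]
  ext1
  · ring
  ext1
  · linear_combination (norm := module) (24 * d ^ 3) • hjk - (8 * d ^ 4) • hkk
  ext1
  · linear_combination (norm := module) (8 * d ^ 2) • hjj - (24 * d ^ 3) • hkj
  · ring

end ReducedAlbert

namespace ReducedAlbert

variable {F : Type u} [Field F] {A : ReducedAlbert.{u, v} F} (h2 : (2 : F) ≠ 0)

lemma Dsub_add_mem {x y : A.Bam × A.Bam} (hx : x ∈ A.Dsub) (hy : y ∈ A.Dsub) :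
    x + y ∈ A.Dsub := by
  obtain ⟨a, b, j, k, hj, hk, rfl⟩ := mem_Dsub.1 hx
  obtain ⟨a', b', j', k', hj', hk', rfl⟩ := mem_Dsub.1 hy
  refine mem_Dsub.2 ⟨a + a', b + b', j + j', k + k', A.J.add_mem hj hj', A.J.add_mem hk hk', ?_⟩
  simp only [Prod.mk_add_mk, neg_add]

/-- A symmetric triadditive map vanishing on the diagonal is zero if `6` is invertible. -/
lemma eq_zero_of_diag {F V W : Type*} [Field F] [AddCommGroup V] [AddCommGroup W] [Module F W]
    (h6 : (6 : F) ≠ 0) {S : Set V} (hS : ∀ x ∈ S, ∀ y ∈ S, x + y ∈ S) (G : V → V → V → W)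
    (hadd : ∀ x x' y z, G (x + x') y z = G x y z + G x' y z)
    (hl : ∀ x y z, G x y z = G y x z) (hr : ∀ x y z, G x y z = G x z y)
    (h0 : ∀ x ∈ S, G x x x = 0) {x y z : V} (hx : x ∈ S) (hy : y ∈ S) (hz : z ∈ S) :
    G x y z = 0 := by
  have hadd2 : ∀ x y y' z, G x (y + y') z = G x y z + G x y' z := fun x y y' z => by
    rw [hl, hadd, hl y, hl y']
  have hadd3 : ∀ x y z z', G x y (z + z') = G x y z + G x y z' := fun x y z z' => by
    rw [hr, hadd2, hr x z, hr x z']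
  have hxy := h0 _ (hS x hx y hy)
  have hxz := h0 _ (hS x hx z hz)
  have hyz := h0 _ (hS y hy z hz)
  have hxyz := h0 _ (hS _ (hS x hx y hy) z hz)
  simp only [hadd, hadd2, hadd3, h0 x hx, h0 y hy, h0 z hz] at hxy hxz hyz hxyz
  have hxxy : ∀ x y, G x y x = G x x y ∧ G y x x = G x x y := fun x y =>
    ⟨hr x y x, by rw [hl, hr]⟩
  have e1 : G y x z = G x y z := hl y x z
  have e2 : G x z y = G x y z := hr x z y
  have e3 : G y z x = G x y z := by rw [hr, e1]
  have e4 : G z x y = G x y z := by rw [hl, e2]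
  have e5 : G z y x = G x y z := by rw [hr, e4]
  simp only [hxxy] at hxy hxz hyz hxyz
  simp only [e1, e2, e3, e4, e5] at hxyz
  refine (smul_eq_zero_iff_right h6).1 ?_
  linear_combination (norm := module) hxyz - hxy - hxz - hyz

include h2 in
lemma tform_descent (h3 : (3 : F) ≠ 0) (d : F) {x y z : A.Bam × A.Bam} (hx : x ∈ A.Dsub)
    (hy : y ∈ A.Dsub) (hz : z ∈ A.Dsub) :
    A.tform 1 (A.descent d x) (A.descent d y) (A.descent d z) =
      (-2 * d) • A.descent d
        (d • (A.tform 1 x.1 y.1 z.2 + A.tform 1 x.1 y.2 z.1 + A.tform 1 x.2 y.1 z.1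
          + d • A.tform 1 x.2 y.2 z.2),
        A.tform 1 x.1 y.1 z.1 + d • (A.tform 1 x.1 y.2 z.2 + A.tform 1 x.2 y.1 z.2
          + A.tform 1 x.2 y.2 z.1)) := by
  have h6 : (6 : F) ≠ 0 := by
    rw [show (6 : F) = 2 * 3 by norm_num]; exact mul_ne_zero h2 h3
  rw [← sub_eq_zero]
  refine eq_zero_of_diag (S := A.Dsub) h6 (fun x hx y hy => Dsub_add_mem hx hy)
    (fun x y z => A.tform 1 (A.descent d x) (A.descent d y) (A.descent d z) -
      (-2 * d) • A.descent d
        (d • (A.tform 1 x.1 y.1 z.2 + A.tform 1 x.1 y.2 z.1 + A.tform 1 x.2 y.1 z.1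
          + d • A.tform 1 x.2 y.2 z.2),
        A.tform 1 x.1 y.1 z.1 + d • (A.tform 1 x.1 y.2 z.2 + A.tform 1 x.2 y.1 z.2
          + A.tform 1 x.2 y.2 z.1))) (fun x x' y z => ?_) (fun x y z => ?_)
    (fun x y z => ?_) (fun x hx => ?_) hx hy hz
  · simp only [map_add, Prod.fst_add, Prod.snd_add, tform_add_left h2]
    rw [sub_add_sub_comm, ← smul_add, ← map_add, Prod.mk_add_mk]
    congr 4
    · module
    · module
  · simp only [tform_comm_left h2 y.1 x.1, tform_comm_left h2 y.1 x.2,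
      tform_comm_left h2 y.2 x.1, tform_comm_left h2 y.2 x.2,
      tform_comm_left h2 (A.descent d y) (A.descent d x)]
    congr 4
    · module
    · module
  · simp only [tform_comm_right h2 _ z.1 y.1, tform_comm_right h2 _ z.1 y.2,
      tform_comm_right h2 _ z.2 y.1, tform_comm_right h2 _ z.2 y.2,
      tform_comm_right h2 _ (A.descent d z) (A.descent d y)]
    congr 4
    · module
    · module
  · rw [tform_descent_self h2 h3 d hx, sub_self]

lemma one_mem_J : (1 : A.M) ∈ A.J := by
  intro i j
  rcases eq_or_ne i j with rfl | h
  · rw [Matrix.one_apply_eq, OctonionAlgebra.conj_one, inv_mul_cancel₀ (A.γ i).ne_zero, one_smul]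
  · rw [Matrix.one_apply_ne h, Matrix.one_apply_ne h.symm, map_zero, smul_zero]

include h2

lemma bijOn_descent {d : F} (hd : d ≠ 0) :
    Set.BijOn (A.descent d) A.Dsub (A.Bsub : Set A.Bam) := by
  have h4 : (4 : F) ≠ 0 := by
    rw [show (4 : F) = 2 * 2 by norm_num]; exact mul_ne_zero h2 h2
  refine ⟨fun x hx => ?_, fun x hx y hy h => ?_, ?_⟩
  · obtain ⟨a, b, j, k, hj, hk, rfl⟩ := mem_Dsub.1 hx
    exact ⟨A.J.smul_mem _ (A.J.add_mem (A.J.smul_mem _ one_mem_J) (A.J.smul_mem _ hj)),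
      A.J.smul_mem _ (A.J.add_mem (A.J.smul_mem _ one_mem_J) (A.J.smul_mem _ hk))⟩
  · obtain ⟨a, b, j, k, hj, hk, rfl⟩ := mem_Dsub.1 hx
    obtain ⟨a', b', j', k', hj', hk', rfl⟩ := mem_Dsub.1 hy
    have aux : ∀ {a a' : F} {j j' : A.M}, a + A.traceL j = a' + A.traceL j' →
        (a - A.traceL j) • (1 : A.M) + (2 : F) • j
          = (a' - A.traceL j') • (1 : A.M) + (2 : F) • j' → a = a' ∧ j = j' := by
      intro a a' j j' h h'
      have ht := congrArg A.traceL h'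
      simp only [map_add, map_smul, A.traceL_one h2, smul_eq_mul] at ht
      have ha : a = a' := mul_left_cancel₀ h4 (by linear_combination ht + h)
      subst ha
      rw [add_left_cancel h] at h'
      exact ⟨rfl, smul_right_injective _ h2 (add_left_cancel h')⟩
    simp only [descent_apply, Prod.mk.injEq] at h
    obtain ⟨e1, e2, e3, e4⟩ := h
    obtain ⟨rfl, rfl⟩ := aux e1 (smul_right_injective _ hd e2)
    obtain ⟨rfl, rfl⟩ := aux (mul_left_cancel₀ (pow_ne_zero 2 hd) e4)
      (smul_right_injective _ hd e3)
    rfl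
  · rintro ⟨p, q, q', p'⟩ ⟨hq, hq'⟩
    have aux : ∀ (p : F) {q : A.M}, q ∈ A.J → ∃ a : F, ∃ j ∈ A.J,
        a + A.traceL j = p ∧ (a - A.traceL j) • (1 : A.M) + (2 : F) • j = q := by
      intro p q hq
      have hj : A.traceL ((2 : F)⁻¹ • (q - ((4 : F)⁻¹ * (2 * A.traceL q - 2 * p)) • (1 : A.M)))
          = (4 : F)⁻¹ * (3 * p - A.traceL q) := by
        simp only [map_smul, map_sub, A.traceL_one h2, smul_eq_mul]
        field_simp
        ring
      refine ⟨(4 : F)⁻¹ * (p + A.traceL q), _, A.J.smul_mem (2 : F)⁻¹ (A.J.sub_mem hq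
        (A.J.smul_mem ((4 : F)⁻¹ * (2 * A.traceL q - 2 * p)) one_mem_J)), ?_, ?_⟩
      · rw [hj]; field_simp; ring
      · rw [hj, smul_smul, mul_inv_cancel₀ h2]; module
    obtain ⟨a, j, hj, e1, e2⟩ := aux p (A.J.smul_mem d⁻¹ hq)
    obtain ⟨b, k, hk, e3, e4⟩ := aux ((d ^ 2)⁻¹ * p') (A.J.smul_mem d⁻¹ hq')
    refine ⟨((a, j, j, a), (b, k, -k, -b)), mem_Dsub.2 ⟨a, b, j, k, hj, hk, rfl⟩, ?_⟩
    simp only [descent_apply, e1, e2, e3, e4, smul_smul, mul_inv_cancel₀ hd, one_smul,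
      mul_inv_cancel_left₀ (pow_ne_zero 2 hd)]

end ReducedAlbert

/-- For every reduced Albert algebra `J` and every quadratic étale
`F`-algebra `Δ` (`Δ = F(√d)`, `d ∈ F^×`), `B(J,Δ)` is similar to `B(J,F×F)`: for any choices
of nonzero skew-symmetric elements `c·δs₀` and `c'·s₀` in the two algebras there are a
bijective `F`-linear map `f : B(J,Δ) → B(J,F×F)` and `λ ∈ F^×` forming a similarity between
the associated triple systems. -/
theorem stmt12 {F : Type u} [Field F] (h2 : (2 : F) ≠ 0) (h3 : (3 : F) ≠ 0)
    (A : ReducedAlbert.{u, v} F) (d : Fˣ) (c c' : Fˣ) :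
    ∃ (lam : Fˣ) (f : (A.Bam × A.Bam) →ₗ[F] A.Bam),
      Set.BijOn f A.Dsub (A.Bsub : Set A.Bam) ∧
      (∀ x ∈ A.Dsub, ∀ y ∈ A.Dsub,
        A.bformS 1 ((c' : F) • A.s0) (f x) (f y)
          = (lam : F) * A.dbform (d : F) ((c : F) • A.ds0) x y) ∧
      (∀ x ∈ A.Dsub, ∀ y ∈ A.Dsub, ∀ z ∈ A.Dsub,
        A.tformS 1 ((c' : F) • A.s0) (f x) (f y) (f z)
          = (lam : F) • f (A.dtform (d : F) ((c : F) • A.ds0) x y z)) := by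
  refine ⟨Units.mk0 ((c' : F) * (-2 * d) * (c : F)⁻¹) (by simp [h2]), A.descent d,
    ReducedAlbert.bijOn_descent h2 d.ne_zero, fun x hx y hy => ?_, fun x hx y hy z hz => ?_⟩
  · rw [ReducedAlbert.bformS_smul, ReducedAlbert.bform_descent h2 _ hx hy,
      ReducedAlbert.dbform_apply h2, Units.val_mk0]
    field_simp
  · rw [ReducedAlbert.tformS_smul h2, ReducedAlbert.dtform_apply h2 _ _ hx hy hz, Units.val_mk0,
      map_smul, smul_smul, inv_mul_cancel_right₀ c.ne_zero, mul_smul,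
      ReducedAlbert.tform_descent h2 h3 _ hx hy hz]
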